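/- arXiv:2505.00952 — 2 statements merged into one kernel-verified Lean document; each statement's English description precedes it below -/
import Mathlib

section
/- Let G be a finite group, let A be a simple C*-algebra, and let α : G → Aut(A) be an action of G on A. Then α has the weak tracial Rokhlin property if and only if the following condition holds: for every ε > 0, every finite set F ⊆ A, and every pair of positive elements x, y ∈ A with ‖x‖ = 1, there exist positive contractions f_g ∈ A (for g ∈ G) such that, with f = Σ_{g∈G} f_g, one has: (1) ‖f_g f_h‖ < ε for all g, h ∈ G with g ≠ h; (2) ‖a f_g − f_g a‖ < ε for all g ∈ G and all a ∈ F; (3) ‖α_g(f_h) − f_{gh}‖ < ε for all g, h ∈ G; (4) (y² − y f y − ε)₊ ≾_A x; (5) ‖f x f‖ > 1 − ε; (6) f belongs to the fixed point algebra A^α and ‖f‖ = 1. -/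
open Filter Topology

variable {A : Type*} [NonUnitalCStarAlgebra A] [PartialOrder A] [StarOrderedRing A]

/-- `(a - ε)₊`, the positive cut-down of `a`, obtained by applying the continuous
functional calculus with the function `t ↦ max (t - ε) 0`. -/
noncomputable def cutdown (a : A) (ε : ℝ) : A :=
  cfcₙ (fun t : ℝ => max (t - ε) 0) a

/-- Cuntz subequivalence of `a` and `b`, with the witnessing sequence taken from `S`:
there is a sequence `(w n)` in `S` with `‖w n * b * (w n)⋆ - a‖ → 0`.
Taking `S = Set.univ` gives Cuntz subequivalence in `A`. -/
def CuntzLEIn (S : Set A) (a b : A) : Prop :=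
  ∃ w : ℕ → A, (∀ n, w n ∈ S) ∧
    Tendsto (fun n => ‖w n * b * star (w n) - a‖) atTop (𝓝 0)

/-- A C*-algebra is simple if it is nonzero and its only closed two-sided ideals
are `⊥` and `⊤`. -/
def IsSimpleCStarAlgebra (A : Type*) [NonUnitalCStarAlgebra A] : Prop :=
  (∃ a : A, a ≠ 0) ∧ ∀ I : TwoSidedIdeal A, IsClosed (I : Set A) → I = ⊥ ∨ I = ⊤

/-- The fixed point algebra of an action `α` of `G` on `A`. -/
def fixedPts {G : Type*} (α : G → A ≃⋆ₐ[ℂ] A) : Set A :=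
  {a : A | ∀ g : G, α g a = a}

/-- The weak tracial Rokhlin property for an action of a finite group `G` on a simple
C*-algebra `A`: for every `ε > 0`, finite set `F ⊆ A`, and positive `x, y ∈ A` with
`‖x‖ = 1` there are pairwise orthogonal positive contractions `f g` such that, with
`f = ∑ g, f g`: `f g` almost commutes with `F`, `α g (f h)` is close to `f (g * h)`,
`(y² - y f y - ε)₊ ≾_A x`, and `‖f x f‖ > 1 - ε`. -/
def WeakTracialRokhlin {G : Type*} [Group G] [Fintype G] (α : G → A ≃⋆ₐ[ℂ] A) : Prop :=
  ∀ (ε : ℝ), 0 < ε → ∀ (F : Finset A) (x y : A), 0 ≤ x → 0 ≤ y → ‖x‖ = 1 →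
    ∃ f : G → A,
      (∀ g, 0 ≤ f g) ∧ (∀ g, ‖f g‖ ≤ 1) ∧
      (∀ g h, g ≠ h → f g * f h = 0) ∧
      (∀ g, ∀ a ∈ F, ‖a * f g - f g * a‖ < ε) ∧
      (∀ g h, ‖α g (f h) - f (g * h)‖ < ε) ∧
      CuntzLEIn Set.univ (cutdown (y * y - y * (∑ g : G, f g) * y) ε) x ∧
      ‖(∑ g : G, f g) * x * (∑ g : G, f g)‖ > 1 - ε

/-- Cuntz subequivalence in terms of approximations instead of sequences. -/
lemma cuntzLEIn_univ_iff {B : Type*} [NonUnitalCStarAlgebra B] {a b : B} :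
    CuntzLEIn Set.univ a b ↔ ∀ δ > 0, ∃ w : B, ‖w * b * star w - a‖ < δ := by
  constructor
  · rintro ⟨w, -, hw⟩ δ hδ
    obtain ⟨n, hn⟩ := (hw.eventually (gt_mem_nhds hδ)).exists
    exact ⟨w n, hn⟩
  · intro h
    choose w hw using fun n : ℕ => h (1 / ((n : ℝ) + 1)) (by positivity)
    exact ⟨w, fun _ => Set.mem_univ _, squeeze_zero (fun _ => norm_nonneg _)
      (fun n => (hw n).le) tendsto_one_div_add_atTop_nhds_zero_nat⟩

lemma CuntzLEIn.trans_conj {B : Type*} [NonUnitalCStarAlgebra B] {a b c : B} (d : B)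
    (hab : CuntzLEIn Set.univ a (d * b * star d)) (hbc : CuntzLEIn Set.univ b c) :
    CuntzLEIn Set.univ a c := by
  rw [cuntzLEIn_univ_iff] at *
  intro δ hδ
  obtain ⟨w, hw⟩ := hab (δ / 2) (by positivity)
  obtain ⟨v, hv⟩ := hbc (δ / (2 * (‖w * d‖ * ‖w * d‖ + 1))) (by positivity)
  refine ⟨w * d * v, ?_⟩
  have hsplit : w * d * v * c * star (w * d * v) - a
      = w * d * (v * c * star v - b) * star (w * d) + (w * (d * b * star d) * star w - a) := by
    simp only [star_mul]; noncomm_ring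
  have hconj : ‖w * d * (v * c * star v - b) * star (w * d)‖ ≤ δ / 2 := by
    refine (norm_mul_le_of_le (norm_mul_le _ _) (norm_star _).le).trans ?_
    rw [lt_div_iff₀ (by positivity)] at hv
    nlinarith [norm_nonneg (v * c * star v - b)]
  rw [hsplit]
  exact (norm_add_le _ _).trans_lt (by linarith)

lemma cfcₙ_mul_self_mul {B : Type*} [NonUnitalCStarAlgebra B] {φ : ℝ → ℝ} {a : B}
    (ha : IsSelfAdjoint a) (hφ : ContinuousOn φ (quasispectrum ℝ a)) (hφ0 : φ 0 = 0) :
    cfcₙ φ a * a * cfcₙ φ a = cfcₙ (fun t => φ t * t * φ t) a := by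
  rw [cfcₙ_mul (fun t => φ t * t) φ a (hφ.mul continuousOn_id) (by simp) hφ hφ0,
    cfcₙ_mul φ (fun t => t) a hφ hφ0 continuousOn_id rfl, cfcₙ_id' ℝ a]

lemma cfcₙ_sub_mul_sub_mul_add {B : Type*} [NonUnitalCStarAlgebra B] {φ : ℝ → ℝ} {a : B}
    (ha : IsSelfAdjoint a) (hφ : ContinuousOn φ (quasispectrum ℝ a)) (hφ0 : φ 0 = 0) :
    a - cfcₙ φ a * a - a * cfcₙ φ a + cfcₙ φ a * a * cfcₙ φ a
      = cfcₙ (fun t => t - φ t * t - t * φ t + φ t * t * φ t) a := by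
  have h1 : ContinuousOn (fun t => φ t * t) (quasispectrum ℝ a) := hφ.mul continuousOn_id
  have h2 : ContinuousOn (fun t => t * φ t) (quasispectrum ℝ a) := continuousOn_id.mul hφ
  rw [cfcₙ_mul_self_mul ha hφ hφ0,
    cfcₙ_add (fun t => t - φ t * t - t * φ t) (fun t => φ t * t * φ t) a
      ((continuousOn_id.sub h1).sub h2) (by simp) (h1.mul hφ) (by simp),
    cfcₙ_sub (fun t => t - φ t * t) (fun t => t * φ t) a (continuousOn_id.sub h1) (by simp)
      h2 (by simp),
    cfcₙ_sub (fun t => t) (fun t => φ t * t) a continuousOn_id rfl h1 (by simp),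
    cfcₙ_mul φ (fun t => t) a hφ hφ0 continuousOn_id rfl,
    cfcₙ_mul (fun t => t) φ a continuousOn_id rfl hφ hφ0, cfcₙ_id' ℝ a]

lemma cuntzLEIn_of_le {a b : A} (ha : 0 ≤ a) (hab : a ≤ b) : CuntzLEIn Set.univ a b := by
  have hb : 0 ≤ b := ha.trans hab
  have hbs : IsSelfAdjoint b := .of_nonneg hb
  rw [cuntzLEIn_univ_iff]
  intro δ hδ
  obtain ⟨s, hs, rfl⟩ := CStarAlgebra.nonneg_iff_exists_isSelfAdjoint_and_eq_mul_self.1 ha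
  have hspec : ∀ t ∈ quasispectrum ℝ b, 0 ≤ t := quasispectrum_nonneg_of_nonneg b hb
  obtain ⟨κ, hκ, hκδ⟩ : ∃ κ : ℝ, 0 < κ ∧ κ + (‖s‖ + ‖s‖) * √κ < δ := by
    have hlim : Tendsto (fun κ : ℝ => κ + (‖s‖ + ‖s‖) * √κ) (𝓝[>] 0) (𝓝 0) := by
      have : Continuous fun κ : ℝ => κ + (‖s‖ + ‖s‖) * √κ := by fun_prop
      simpa using (this.tendsto 0).mono_left nhdsWithin_le_nhds
    obtain ⟨κ, h1, h2⟩ := ((hlim.eventually (gt_mem_nhds hδ)).and self_mem_nhdsWithin).exists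
    exact ⟨κ, h2, h1⟩
  have hne : ∀ t ∈ quasispectrum ℝ b, t + κ ≠ 0 := fun t ht => by linarith [hspec t ht]
  set k : A := cfcₙ (fun t : ℝ => t / (t + κ)) b with hk
  set h : A := cfcₙ (fun t : ℝ => √t / (t + κ)) b with hh
  have hck : ContinuousOn (fun t : ℝ => t / (t + κ)) (quasispectrum ℝ b) :=
    continuousOn_id.div (by fun_prop) hne
  have hch : ContinuousOn (fun t : ℝ => √t / (t + κ)) (quasispectrum ℝ b) :=
    (by fun_prop : ContinuousOn (fun t : ℝ => √t) _).div (by fun_prop) hne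
  have hks : star k = k := IsSelfAdjoint.cfcₙ
  have hhs : star h = h := IsSelfAdjoint.cfcₙ
  have hhbh : h * b * h = k * k := by
    rw [hh, hk, cfcₙ_mul_self_mul hbs hch (by simp), ← cfcₙ_mul _ _ b hck (by simp) hck (by simp)]
    refine cfcₙ_congr fun t ht => ?_
    have h1 := Real.mul_self_sqrt (hspec t ht)
    have h2 := hne t ht
    field_simp
    nlinarith
  have hres : ‖b - k * b - b * k + k * b * k‖ ≤ κ := by
    rw [hk, cfcₙ_sub_mul_sub_mul_add hbs hck (by simp)]
    refine norm_cfcₙ_le fun t ht => ?_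
    have h0 := hspec t ht
    have hpos : 0 < t + κ := by linarith
    have heq : t - t / (t + κ) * t - t * (t / (t + κ)) + t / (t + κ) * t * (t / (t + κ))
        = t * κ ^ 2 / (t + κ) ^ 2 := by field_simp; ring
    rw [heq, Real.norm_of_nonneg (by positivity), div_le_iff₀ (by positivity)]
    nlinarith [mul_nonneg h0 h0, mul_nonneg h0 hκ.le, mul_pos hκ hκ,
      mul_nonneg (mul_nonneg h0 hκ.le) hκ.le, mul_nonneg (mul_nonneg h0 h0) hκ.le,
      mul_pos (mul_pos hκ hκ) hκ]
  have hdiff : ‖s - s * k‖ ≤ √κ := by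
    refine Real.le_sqrt_of_sq_le ?_
    have hle : star (s - s * k) * (s - s * k) ≤ b - k * b - b * k + k * b * k := by
      have hba : 0 ≤ b - s * s := sub_nonneg.2 hab
      obtain ⟨r, hr⟩ := CStarAlgebra.nonneg_iff_eq_star_mul_self.1 hba
      rw [← sub_nonneg]
      have : b - k * b - b * k + k * b * k - star (s - s * k) * (s - s * k)
          = star (r - r * k) * (r - r * k) := by
        have hb' : b = star r * r + s * s := by rw [← hr]; abel
        simp only [star_sub, star_mul, hks, hs.star_eq]
        rw [hb']
        noncomm_ring
      rw [this]
      exact star_mul_self_nonneg _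
    have := CStarAlgebra.norm_le_norm_of_nonneg_of_le (star_mul_self_nonneg _) hle
    rw [CStarRing.norm_star_mul_self] at this
    nlinarith
  refine ⟨s * h, ?_⟩
  have heq : s * h * b * star (s * h) - s * s
      = (s - s * k) * star (s - s * k) - (s * star (s - s * k) + (s - s * k) * s) := by
    have : s * h * b * star (s * h) = s * (k * k) * s := by
      rw [← hhbh, star_mul, hhs, hs.star_eq]; noncomm_ring
    rw [this]
    simp only [star_sub, star_mul, hks, hs.star_eq]
    noncomm_ring
  have hstar : ‖star (s - s * k)‖ ≤ √κ := by rwa [norm_star]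
  calc ‖s * h * b * star (s * h) - s * s‖
      ≤ √κ * √κ + (‖s‖ * √κ + √κ * ‖s‖) := by
        rw [heq]
        exact norm_sub_le_of_le (norm_mul_le_of_le hdiff hstar)
          (norm_add_le_of_le (norm_mul_le_of_le le_rfl hstar) (norm_mul_le_of_le hdiff le_rfl))
    _ = κ + (‖s‖ + ‖s‖) * √κ := by rw [Real.mul_self_sqrt hκ.le]; ring
    _ < δ := hκδ

lemma cutdown_nonneg (a : A) (ε : ℝ) : 0 ≤ cutdown a ε :=
  cfcₙ_nonneg fun _ _ => le_max_right _ _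

lemma norm_sub_cutdown_le {a : A} (ha : 0 ≤ a) {ε : ℝ} (hε : 0 ≤ ε) :
    ‖a - cutdown a ε‖ ≤ ε := by
  have hs : IsSelfAdjoint a := .of_nonneg ha
  nth_rw 1 [cutdown, ← cfcₙ_id' ℝ a]
  rw [← cfcₙ_sub _ _ a (by fun_prop) rfl (by fun_prop) (by simpa)]
  refine norm_cfcₙ_le fun t ht => ?_
  have := quasispectrum_nonneg_of_nonneg a ha t ht
  rw [Real.norm_eq_abs, abs_le]
  grind

/-- If `‖a - b‖ < ε`, then `(a - ε)₊ ≾ b`. -/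
lemma exists_cutdown_le_conj {a b : A} (ha : IsSelfAdjoint a) (hb : IsSelfAdjoint b) {ε : ℝ}
    (h : ‖a - b‖ < ε) : ∃ c : A, cutdown a ε ≤ c * b * star c := by
  have hε : 0 < ε := (norm_nonneg _).trans_lt h
  set η := ‖a - b‖ with hη
  have hpos : ∀ t : ℝ, 0 < max (t - η) (ε - η) := fun t => lt_max_of_lt_right (by linarith)
  set φ : ℝ → ℝ := fun t => √(max (t - ε) 0 / max (t - η) (ε - η)) with hφ
  have hcφ : Continuous φ :=
    Real.continuous_sqrt.comp (Continuous.div (by fun_prop) (by fun_prop) fun t => (hpos t).ne')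
  have hφ0 : φ 0 = 0 := by simp [hφ, hε.le]
  set c : A := cfcₙ φ a with hc
  have hcs : star c = c := IsSelfAdjoint.cfcₙ
  have hkey : c * a * c - η • (c * c) = cutdown a ε := by
    have hc1 : ContinuousOn (fun t => φ t * t * φ t) (quasispectrum ℝ a) :=
      ((hcφ.mul continuous_id).mul hcφ).continuousOn
    have hc2 : ContinuousOn (fun t => φ t * φ t) (quasispectrum ℝ a) := (hcφ.mul hcφ).continuousOn
    rw [hc, cfcₙ_mul_self_mul ha hcφ.continuousOn hφ0,
      ← cfcₙ_mul φ φ a hcφ.continuousOn hφ0 hcφ.continuousOn hφ0,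
      ← cfcₙ_smul η (fun t => φ t * φ t) a hc2 (by simp [hφ0]),
      ← cfcₙ_sub (fun t => φ t * t * φ t) (fun t => η • (φ t * φ t)) a hc1 (by simp)
        (hc2.const_smul η) (by simp [hφ0]), cutdown]
    refine cfcₙ_congr fun t _ => ?_
    have h1 : φ t * φ t = max (t - ε) 0 / max (t - η) (ε - η) :=
      Real.mul_self_sqrt (div_nonneg (le_max_right _ _) (hpos t).le)
    have h2 : φ t * t * φ t - η • (φ t * φ t) = (t - η) * (φ t * φ t) := by
      simp only [smul_eq_mul]; ring
    refine h2.trans ?_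
    rw [h1]
    rcases le_total t ε with hle | hle
    · simp [hle]
    · rw [max_eq_left (by linarith : ε - η ≤ t - η)]
      field_simp [show t - η ≠ 0 by linarith]
  refine ⟨c, ?_⟩
  have hle := CStarAlgebra.star_right_conjugate_le_norm_smul (a := c) (ha.sub hb)
  rw [← hkey, hcs, sub_le_iff_le_add]
  rw [hcs, mul_sub, sub_mul, sub_le_iff_le_add', ← hη] at hle
  exact hle

lemma CuntzLEIn.cutdown_of_norm_sub_lt {a b x : A} (ha : IsSelfAdjoint a) (hb : 0 ≤ b)
    {ε δ : ℝ} (hδ : 0 ≤ δ) (h : ‖a - b‖ + δ < ε) (hbx : CuntzLEIn Set.univ (cutdown b δ) x) :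
    CuntzLEIn Set.univ (cutdown a ε) x := by
  have hlt : ‖a - cutdown b δ‖ < ε :=
    (norm_sub_le_norm_sub_add_norm_sub _ b _).trans_lt
      (by linarith [norm_sub_cutdown_le hb hδ])
  obtain ⟨c, hc⟩ := exists_cutdown_le_conj ha (.of_nonneg (cutdown_nonneg b δ)) hlt
  exact (cuntzLEIn_of_le (cutdown_nonneg a ε) hc).trans_conj c hbx

/-- Given `κ > 0`, every positive `a` has a cut-down `r` close to `a` with a local unit `p`
that factors through `a`. -/
lemma exists_cutdown_localUnit {κ : ℝ} (hκ : 0 < κ) {a : A} (ha : 0 ≤ a) :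
    ∃ r p u v : A, 0 ≤ r ∧ IsSelfAdjoint p ∧ ‖r - a‖ ≤ κ ∧ ‖p‖ ≤ 1 ∧ r * p = r ∧
      r = v * a ∧ r = a * v ∧ p = u * a ∧ p = a * u ∧ ‖u‖ ≤ 2 / κ := by
  have hs : IsSelfAdjoint a := .of_nonneg ha
  set ρ : ℝ → ℝ := fun t => max (t - κ) 0 with hρ
  set φ : ℝ → ℝ := fun t => min 1 (max (2 * t / κ - 1) 0) with hφ
  set ψ : ℝ → ℝ := fun t => φ t / max t (κ / 2) with hψ
  set χ : ℝ → ℝ := fun t => ρ t / max t κ with hχ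
  have hpos : ∀ t, 0 < max t (κ / 2) := fun t => lt_max_of_lt_right (by positivity)
  have hpos' : ∀ t, 0 < max t κ := fun t => lt_max_of_lt_right hκ
  have hcρ : Continuous ρ := by fun_prop
  have hcφ : Continuous φ := by fun_prop
  have hcψ : Continuous ψ := hcφ.div (by fun_prop) fun t => (hpos t).ne'
  have hcχ : Continuous χ := hcρ.div (by fun_prop) fun t => (hpos' t).ne'
  have hρ0 : ρ 0 = 0 := by simp [hρ, hκ.le]
  have hφ0 : φ 0 = 0 := by simp [hφ]
  have hψ0 : ψ 0 = 0 := by simp [hψ, hφ0]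
  have hχ0 : χ 0 = 0 := by simp [hχ, hρ0]
  have hφ1 : ∀ t, 0 ≤ φ t ∧ φ t ≤ 1 := fun t =>
    ⟨le_min zero_le_one (le_max_right _ _), min_le_left _ _⟩
  have hψφ : ∀ t, ψ t * t = φ t := fun t => by
    rcases le_total t (κ / 2) with h | h
    · have : φ t = 0 := by
        have : 2 * t / κ - 1 ≤ 0 := by rw [sub_nonpos, div_le_one hκ]; linarith
        simp [hφ, this]
      simp [hψ, this]
    · have : t ≠ 0 := by linarith
      simp only [hψ, max_eq_left h]
      field_simp
  have hχρ : ∀ t, χ t * t = ρ t := fun t => by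
    rcases le_total t κ with h | h
    · simp [hχ, hρ, h]
    · have : t ≠ 0 := by linarith
      simp only [hχ, max_eq_left h]
      field_simp
  have hρφ : ∀ t, ρ t * φ t = ρ t := fun t => by
    rcases le_total t κ with h | h
    · simp [hρ, h]
    · have : 1 ≤ 2 * t / κ - 1 := by rw [le_sub_iff_add_le, le_div_iff₀ hκ]; linarith
      have : φ t = 1 := min_eq_left (this.trans (le_max_left _ _))
      rw [this, mul_one]
  have hmul : ∀ f g : ℝ → ℝ, Continuous f → Continuous g → f 0 = 0 → g 0 = 0 →
      cfcₙ f a * cfcₙ g a = cfcₙ (fun t => f t * g t) a := fun f g hf hg hf0 hg0 =>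
    (cfcₙ_mul f g a hf.continuousOn hf0 hg.continuousOn hg0).symm
  have hid : cfcₙ (fun t : ℝ => t) a = a := cfcₙ_id' ℝ a
  refine ⟨cfcₙ ρ a, cfcₙ φ a, cfcₙ ψ a, cfcₙ χ a, cfcₙ_nonneg fun t _ => le_max_right _ _,
    IsSelfAdjoint.cfcₙ, ?_, norm_cfcₙ_le fun t _ => ?_, ?_, ?_, ?_, ?_, ?_,
    norm_cfcₙ_le fun t _ => ?_⟩
  · rw [norm_sub_rev]
    exact norm_sub_cutdown_le ha hκ.le
  · rw [Real.norm_of_nonneg (hφ1 t).1]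
    exact (hφ1 t).2
  · rw [hmul ρ φ hcρ hcφ hρ0 hφ0]
    simp only [hρφ]
  · nth_rw 3 [← hid]
    rw [hmul χ (fun t => t) hcχ continuous_id hχ0 rfl]
    simp only [hχρ]
  · nth_rw 2 [← hid]
    rw [hmul (fun t => t) χ continuous_id hcχ rfl hχ0]
    simp only [mul_comm _ (χ _), hχρ]
  · nth_rw 3 [← hid]
    rw [hmul ψ (fun t => t) hcψ continuous_id hψ0 rfl]
    simp only [hψφ]
  · nth_rw 2 [← hid]
    rw [hmul (fun t => t) ψ continuous_id hcψ rfl hψ0]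
    simp only [mul_comm _ (ψ _), hψφ]
  · rw [Real.norm_of_nonneg (div_nonneg (hφ1 t).1 (hpos t).le), div_le_div_iff₀ (hpos t) hκ]
    have := le_max_right t (κ / 2)
    nlinarith [hφ1 t]

/-- Almost orthogonal positive contractions are close to positive elements which are orthogonal
on a prescribed finite set of indices. -/
lemma exists_orthogonal_on {ι : Type*} (s : Finset ι) {η : ℝ} (hη : 0 < η) :
    ∃ δ > 0, ∀ f : ι → A, (∀ i, 0 ≤ f i) → (∀ i, ‖f i‖ ≤ 1) →
      (∀ i j, i ≠ j → ‖f i * f j‖ < δ) →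
      ∃ f' : ι → A, (∀ i, 0 ≤ f' i) ∧ (∀ i, ‖f' i - f i‖ < η) ∧
        ∀ i ∈ s, ∀ j ∈ s, i ≠ j → f' i * f' j = 0 := by
  classical
  induction s using Finset.induction_on generalizing η with
  | empty => exact ⟨1, one_pos, fun f hf _ _ => ⟨f, hf, fun i => by simpa using hη, by simp⟩⟩
  | insert k s hk ih =>
    set m := (s.card : ℝ) with hm
    have hm0 : 0 ≤ m := Nat.cast_nonneg _
    set κ := η / 2 with hκdef
    have hκ : 0 < κ := by positivity
    obtain ⟨θ, hθ, hθ1, hθ2⟩ : ∃ θ > 0, κ + θ < η ∧ (2 + m) * (m * (2 / κ * (2 * θ))) < η := by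
      have hlim : Tendsto (fun θ : ℝ => (2 + m) * (m * (2 / κ * (2 * θ)))) (𝓝[>] 0) (𝓝 0) := by
        have : Continuous fun θ : ℝ => (2 + m) * (m * (2 / κ * (2 * θ))) := by fun_prop
        simpa using (this.tendsto 0).mono_left nhdsWithin_le_nhds
      have hlim' : Tendsto (fun θ : ℝ => κ + θ) (𝓝[>] 0) (𝓝 κ) := by
        have : Continuous fun θ : ℝ => κ + θ := by fun_prop
        simpa using (this.tendsto 0).mono_left nhdsWithin_le_nhds
      obtain ⟨θ, ⟨h1, h2⟩, h3⟩ := (((hlim.eventually (gt_mem_nhds hη)).and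
        (hlim'.eventually (gt_mem_nhds (by linarith : κ < η)))).and self_mem_nhdsWithin).exists
      exact ⟨θ, h3, h2, h1⟩
    obtain ⟨δ, hδ, ih⟩ := ih hθ
    refine ⟨min δ θ, lt_min hδ hθ, fun f hf hf1 horth => ?_⟩
    obtain ⟨f', hf'0, hf'f, hf'orth⟩ := ih f hf hf1 fun i j hij =>
      (horth i j hij).trans_le (min_le_left _ _)
    choose r p u v hr hp hrf hp1 hrp hrv hrv' hpu hpu' hu using
      fun i => exists_cutdown_localUnit hκ (hf'0 i)
    set q := ∑ i ∈ s, p i with hq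
    have hqs : star q = q := by simp [hq, (hp _).star_eq]
    have hrq : ∀ i ∈ s, r i * q = r i := fun i hi => by
      rw [hq, Finset.mul_sum, Finset.sum_eq_single_of_mem i hi fun j hj hji => ?_, hrp]
      rw [hrv, hpu' j, mul_assoc, ← mul_assoc (f' i), hf'orth i hi j hj hji.symm]
      simp
    have hqn : ‖q‖ ≤ m := by
      simpa [hm] using norm_sum_le_of_le s fun i _ => hp1 i
    have hqf : ‖q * f k‖ ≤ m * (2 / κ * (2 * θ)) := by
      rw [hq, Finset.sum_mul, hm, ← nsmul_eq_mul]
      refine norm_sum_le_of_le s (f := fun i => p i * f k)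
        (n := fun _ => 2 / κ * (2 * θ)) (fun i hi => ?_) |>.trans_eq (by simp)
      rw [hpu, mul_assoc]
      refine norm_mul_le_of_le (hu i) ?_
      have hik : i ≠ k := fun h => hk (h ▸ hi)
      have h1 : f' i * f k = (f' i - f i) * f k + f i * f k := by noncomm_ring
      rw [h1, two_mul]
      refine norm_add_le_of_le ?_ ((horth i k hik).le.trans (min_le_right _ _))
      simpa using norm_mul_le_of_le (hf'f i).le (hf1 k)
    have hfk : star (f k) = f k := (IsSelfAdjoint.of_nonneg (hf k)).star_eq
    have hfq : ‖f k * q‖ ≤ m * (2 / κ * (2 * θ)) := by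
      rw [← norm_star, star_mul, hqs, hfk]
      exact hqf
    set t := f k - q * f k - f k * q + q * (f k * q) with ht
    have ht0 : 0 ≤ t := by
      obtain ⟨w, hw⟩ := CStarAlgebra.nonneg_iff_eq_star_mul_self.1 (hf k)
      have : t = star (w - w * q) * (w - w * q) := by
        rw [ht, hw, star_sub, star_mul, hqs]
        noncomm_ring
      rw [this]
      exact star_mul_self_nonneg _
    have hrt : ∀ i ∈ s, r i * t = 0 := fun i hi => by
      have : r i * t = r i * f k - (r i * q) * f k - r i * f k * q + (r i * q) * f k * q := by
        rw [ht]; noncomm_ring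
      rw [this, hrq i hi]
      abel
    have htr : ∀ i ∈ s, t * r i = 0 := fun i hi => by
      have := congr_arg star (hrt i hi)
      rwa [star_mul, star_zero, (IsSelfAdjoint.of_nonneg ht0).star_eq,
        (IsSelfAdjoint.of_nonneg (hr i)).star_eq] at this
    have hrr : ∀ i ∈ s, ∀ j ∈ s, i ≠ j → r i * r j = 0 := fun i hi j hj hij => by
      rw [hrv, hrv' j, mul_assoc, ← mul_assoc (f' i), hf'orth i hi j hj hij]
      simp
    refine ⟨fun i => if i = k then t else r i, fun i => ?_, fun i => ?_, ?_⟩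
    · dsimp only
      split_ifs
      exacts [ht0, hr i]
    · dsimp only
      split_ifs with h
      · subst h
        have : t - f i = q * (f i * q) - (q * f i + f i * q) := by rw [ht]; abel
        rw [this]
        refine lt_of_le_of_lt (norm_sub_le_of_le (norm_mul_le_of_le hqn hfq)
          (norm_add_le_of_le hqf hfq)) (lt_of_eq_of_lt (by ring) hθ2)
      · exact (norm_sub_le_norm_sub_add_norm_sub _ (f' i) _).trans_lt
          ((add_lt_add_of_le_of_lt (hrf i) (hf'f i)).trans hθ1)
    · intro i hi j hj hij
      rw [Finset.mem_insert] at hi hj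
      dsimp only
      split_ifs with h1 h2 h2
      · exact absurd (h1.trans h2.symm) hij
      · exact htr j (hj.resolve_left h2)
      · exact hrt i (hi.resolve_left h1)
      · exact hrr i (hi.resolve_left h1) j (hj.resolve_left h2) hij

/-- Almost orthogonal positive contractions are close to orthogonal positive contractions. -/
lemma exists_orthogonal_contractions (ι : Type*) [Fintype ι] {η : ℝ} (hη : 0 < η) :
    ∃ δ > 0, ∀ f : ι → A, (∀ i, 0 ≤ f i) → (∀ i, ‖f i‖ ≤ 1) →
      (∀ i j, i ≠ j → ‖f i * f j‖ < δ) →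
      ∃ f' : ι → A, (∀ i, 0 ≤ f' i) ∧ (∀ i, ‖f' i‖ ≤ 1) ∧ (∀ i, ‖f' i - f i‖ ≤ η) ∧
        ∀ i j, i ≠ j → f' i * f' j = 0 := by
  obtain ⟨δ, hδ, H⟩ := exists_orthogonal_on (A := A) (Finset.univ : Finset ι) (half_pos hη)
  refine ⟨δ, hδ, fun f hf hf1 horth => ?_⟩
  obtain ⟨f', hf'0, hf'f, hf'orth⟩ := H f hf hf1 horth
  set c : ℝ := (1 + η / 2)⁻¹ with hc
  have hpos : 0 < 1 + η / 2 := by positivity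
  have hc0 : 0 < c := by positivity
  have hc1 : c * (1 + η / 2) = 1 := inv_mul_cancel₀ hpos.ne'
  have hc2 : c ≤ 1 := by nlinarith
  have hn : ∀ i, ‖f' i‖ ≤ 1 + η / 2 := fun i => by
    simpa using norm_add_le_of_le (hf1 i) (hf'f i).le
  refine ⟨fun i => c • f' i, fun i => smul_nonneg hc0.le (hf'0 i), fun i => ?_, fun i => ?_,
    fun i j hij => ?_⟩
  · rw [norm_smul, Real.norm_of_nonneg hc0.le, ← hc1]
    exact mul_le_mul_of_nonneg_left (hn i) hc0.le
  · have h1 : c • f' i - f i = (c - 1) • f' i + (f' i - f i) := by rw [sub_smul, one_smul]; abel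
    have h2 : ‖(c - 1) • f' i‖ ≤ η / 2 := by
      rw [norm_smul, Real.norm_of_nonpos (by linarith)]
      nlinarith [hn i]
    rw [h1]
    linarith [norm_add_le_of_le h2 (hf'f i).le]
  · rw [smul_mul_smul_comm, hf'orth i (Finset.mem_univ _) j (Finset.mem_univ _) hij, smul_zero]

/-- Averaging almost equivariant positive contractions over the group, and normalising, makes
their sum invariant of norm one. -/
lemma exists_invariant_sum {G : Type*} [Group G] [Fintype G] (α : G → A ≃⋆ₐ[ℂ] A)
    (hα : ∀ g h x, α (g * h) x = α g (α h x)) {δ : ℝ} (hδ : (Fintype.card G + 1) * δ ≤ 1 / 2)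
    {f : G → A} (hf : ∀ g, 0 ≤ f g) (hf1 : ∀ g, ‖f g‖ ≤ 1) (hle : ‖∑ g, f g‖ ≤ 1)
    (hge : 1 - δ ≤ ‖∑ g, f g‖) (hαf : ∀ g h, ‖α g (f h) - f (g * h)‖ ≤ δ) :
    ∃ e : G → A, (∀ g, 0 ≤ e g) ∧ (∀ g, ‖e g‖ ≤ 1) ∧
      (∀ g, ‖e g - f g‖ ≤ 2 * (Fintype.card G + 2) * δ) ∧
      (∑ g, e g) ∈ fixedPts α ∧ ‖∑ g, e g‖ = 1 := by
  set N := (Fintype.card G : ℝ) with hN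
  have hN1 : 1 ≤ N := Nat.one_le_cast.2 Fintype.card_pos
  have hαpos : ∀ g (a : A), 0 ≤ a → 0 ≤ α g a := fun g a ha => by
    obtain ⟨b, rfl⟩ := CStarAlgebra.nonneg_iff_eq_star_mul_self.1 ha
    rw [map_mul, map_star]
    exact star_mul_self_nonneg _
  set E : G → A := fun g => ∑ h, α h (f (h⁻¹ * g)) with hE
  have hE0 : ∀ g, 0 ≤ E g := fun g => Finset.sum_nonneg fun h _ => hαpos _ _ (hf _)
  have hEα : ∀ k g, α k (E g) = E (k * g) := fun k g => by
    simp only [hE, map_sum]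
    refine Fintype.sum_equiv (Equiv.mulLeft k) _ _ fun h => ?_
    simp [hα, mul_assoc]
  set T := ∑ g, E g with hT
  have hTα : ∀ k, α k T = T := fun k => by
    simp only [hT, map_sum, hEα]
    exact Equiv.sum_comp (Equiv.mulLeft k) E
  have hEf : ∀ g, ‖E g - N • f g‖ ≤ N * δ := fun g => by
    have h1 : E g - N • f g = ∑ h, (α h (f (h⁻¹ * g)) - f g) := by
      simp [hE, hN, Finset.sum_sub_distrib, Nat.cast_smul_eq_nsmul]
    rw [h1]
    refine (norm_sum_le_of_le _ fun h _ => ?_).trans_eq (b := ∑ _h : G, δ) (by simp [hN])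
    simpa using hαf h (h⁻¹ * g)
  have hTf : ‖T - N • ∑ g, f g‖ ≤ N * (N * δ) := by
    rw [hT, Finset.smul_sum, ← Finset.sum_sub_distrib]
    exact (norm_sum_le_of_le _ fun g _ => hEf g).trans_eq (by simp [hN])
  have hNf : ‖N • ∑ g, f g‖ = N * ‖∑ g, f g‖ := by
    rw [norm_smul, Real.norm_of_nonneg (by linarith)]
  have habs := abs_le.1 ((abs_norm_sub_norm_le _ _).trans hTf)
  rw [hNf] at habs
  have hTN : |N - ‖T‖| ≤ N * (N * δ) + N * δ := by
    rw [abs_le]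
    constructor <;> nlinarith [habs.1, habs.2]
  have hT2 : N / 2 ≤ ‖T‖ := by nlinarith [(abs_le.1 hTN).2]
  have hTpos : 0 < ‖T‖ := by linarith
  have hc0 : 0 ≤ ‖T‖⁻¹ := by positivity
  have hsum : ∑ g, ‖T‖⁻¹ • E g = ‖T‖⁻¹ • T := by rw [hT, Finset.smul_sum]
  refine ⟨fun g => ‖T‖⁻¹ • E g, fun g => smul_nonneg hc0 (hE0 g), fun g => ?_, fun g => ?_,
    fun k => ?_, ?_⟩
  · rw [norm_smul, Real.norm_of_nonneg hc0, inv_mul_le_one₀ hTpos]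
    exact CStarAlgebra.norm_le_norm_of_nonneg_of_le (hE0 g)
      (Finset.single_le_sum (fun h _ => hE0 h) (Finset.mem_univ g))
  · have h1 : ‖T‖⁻¹ • E g - f g = ‖T‖⁻¹ • ((E g - N • f g) + (N - ‖T‖) • f g) := by
      rw [sub_smul, sub_add_sub_cancel, smul_sub, smul_smul, inv_mul_cancel₀ hTpos.ne', one_smul]
    have h2 : ‖(N - ‖T‖) • f g‖ ≤ N * (N * δ) + N * δ := by
      rw [norm_smul, Real.norm_eq_abs]
      nlinarith [hf1 g, norm_nonneg (f g), abs_nonneg (N - ‖T‖)]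
    have h3 := norm_add_le_of_le (hEf g) h2
    rw [h1, norm_smul, Real.norm_of_nonneg hc0, inv_mul_le_iff₀ hTpos]
    have hδ0 : 0 ≤ δ := (norm_nonneg _).trans (hαf 1 1)
    nlinarith [mul_nonneg (by linarith : 0 ≤ N + 2) hδ0]
  · rw [hsum, ← Complex.coe_smul, map_smul, hTα]
  · rw [hsum, norm_smul, norm_inv, norm_norm, inv_mul_cancel₀ hTpos.ne']

/-- The conditions in the weak tracial Rokhlin property, apart from orthogonality, are stable
under small perturbations of the contractions. -/
lemma exists_perturbation_bound {G : Type*} [Group G] [Fintype G] (α : G → A ≃⋆ₐ[ℂ] A)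
    (F : Finset A) {y : A} (hy : 0 ≤ y) {ε : ℝ} (hε : 0 < ε) :
    ∃ η > 0, 2 * η < ε ∧ ∀ x : A, ‖x‖ = 1 → ∀ δ, 0 ≤ δ → δ ≤ ε / 2 → ∀ f f' : G → A,
      (∀ g, 0 ≤ f g) → (∀ g, 0 ≤ f' g) → ‖∑ g, f g‖ ≤ 1 → (∀ g, ‖f' g - f g‖ ≤ η) →
      (∀ g, ∀ a ∈ F, ‖a * f g - f g * a‖ < δ) →
      (∀ g h, ‖α g (f h) - f (g * h)‖ < δ) →
      CuntzLEIn Set.univ (cutdown (y * y - y * (∑ g, f g) * y) δ) x →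
      ‖(∑ g, f g) * x * (∑ g, f g)‖ > 1 - δ →
      (∀ g, ∀ a ∈ F, ‖a * f' g - f' g * a‖ < ε) ∧
      (∀ g h, ‖α g (f' h) - f' (g * h)‖ < ε) ∧
      CuntzLEIn Set.univ (cutdown (y * y - y * (∑ g, f' g) * y) ε) x ∧
      ‖(∑ g, f' g) * x * (∑ g, f' g)‖ > 1 - ε := by
  set N := (Fintype.card G : ℝ) with hN
  have hsmall : ∀ c : ℝ, ∀ r > 0, ∀ᶠ η : ℝ in 𝓝[>] 0, c * η < r := fun c r hr => by
    have hc : Continuous fun η : ℝ => c * η := by fun_prop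
    exact ((hc.tendsto' 0 0 (by simp)).mono_left nhdsWithin_le_nhds).eventually (gt_mem_nhds hr)
  have hε2 := half_pos hε
  obtain ⟨η, hη, hη2, hηF, hηy, hηN, hηN1⟩ :=
    ((eventually_mem_nhdsWithin (a := (0 : ℝ)) (s := Set.Ioi 0)).and <| (hsmall 2 _ hε2).and <|
      ((Filter.eventually_all_finset F).2 fun a _ => hsmall (‖a‖ + ‖a‖) _ hε2).and <|
      (hsmall (‖y‖ * N * ‖y‖) _ hε2).and <|
      (hsmall (3 * N) _ hε2).and (hsmall N _ one_pos)).exists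
  have hη0 : 0 < η := hη
  refine ⟨η, hη0, by linarith, fun x hx δ hδ0 hδ f f' hf hf' hf1 hff' hcomm hαf hC hnorm => ?_⟩
  set S := ∑ g, f g with hS
  set S' := ∑ g, f' g with hS'
  have hSS' : ‖S' - S‖ ≤ N * η := by
    rw [hS, hS', ← Finset.sum_sub_distrib]
    exact (norm_sum_le_of_le _ fun g _ => hff' g).trans_eq (by simp [hN])
  have hSs : IsSelfAdjoint S := .of_nonneg (Finset.sum_nonneg fun g _ => hf g)
  have hSs' : IsSelfAdjoint S' := .of_nonneg (Finset.sum_nonneg fun g _ => hf' g)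
  have hys : IsSelfAdjoint y := .of_nonneg hy
  refine ⟨fun g a ha => ?_, fun g h => ?_, ?_, ?_⟩
  · have h1 : a * f' g - f' g * a
        = (a * f g - f g * a) + (a * (f' g - f g) - (f' g - f g) * a) := by noncomm_ring
    have h2 := norm_sub_le_of_le (norm_mul_le_of_le (le_refl ‖a‖) (hff' g))
      (norm_mul_le_of_le (hff' g) (le_refl ‖a‖))
    rw [h1]
    refine (norm_add_le_of_le (hcomm g a ha).le h2).trans_lt ?_
    linarith [hηF a ha]
  · have h1 : α g (f' h) - f' (g * h)
        = (α g (f h) - f (g * h)) + (α g (f' h - f h) - (f' (g * h) - f (g * h))) := by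
      rw [map_sub]; abel
    have h2 : ‖α g (f' h - f h)‖ ≤ η :=
      (NonUnitalStarAlgHom.norm_map (α g) (α g).injective _).trans_le (hff' h)
    rw [h1]
    refine (norm_add_le_of_le (hαf g h).le (norm_sub_le_of_le h2 (hff' (g * h)))).trans_lt ?_
    linarith
  · refine hC.cutdown_of_norm_sub_lt ?_ ?_ hδ0 ?_
    · have := hSs'.conjugate y
      rw [hys.star_eq] at this
      exact .sub (by simpa [hys.star_eq] using IsSelfAdjoint.star_mul_self y) this
    · have := CStarAlgebra.star_left_conjugate_le_norm_smul (a := y) hSs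
      rw [hys.star_eq] at this
      refine sub_nonneg.2 (this.trans ?_)
      have hyy : 0 ≤ y * y := by simpa [hys.star_eq] using star_mul_self_nonneg y
      simpa using smul_le_smul_of_nonneg_right hf1 hyy
    · have h1 : y * y - y * S' * y - (y * y - y * S * y) = -(y * (S' - S) * y) := by noncomm_ring
      rw [h1, norm_neg]
      have h2 := norm_mul_le_of_le (norm_mul_le_of_le (le_refl ‖y‖) hSS') (le_refl ‖y‖)
      linarith
  · have h1 : S * x * S = S' * x * S' - ((S' - S) * x * S + S' * x * (S' - S)) := by noncomm_ring
    have hS'1 : ‖S'‖ ≤ 2 := by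
      have := norm_add_le_of_le hf1 hSS'
      rw [add_sub_cancel] at this
      linarith
    have h2 := norm_add_le_of_le
      (norm_mul_le_of_le (norm_mul_le_of_le hSS' hx.le) hf1)
      (norm_mul_le_of_le (norm_mul_le_of_le hS'1 hx.le) hSS')
    have h3 := norm_sub_le_of_le (le_refl ‖S' * x * S'‖) h2
    rw [← h1] at h3
    linarith

lemma norm_sum_le_one_of_orthogonal {ι : Type*} [Fintype ι] {f : ι → A} (hf : ∀ i, 0 ≤ f i)
    (hf1 : ∀ i, ‖f i‖ ≤ 1) (horth : ∀ i j, i ≠ j → f i * f j = 0) : ‖∑ i, f i‖ ≤ 1 := by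
  have := IsSelfAdjoint.nnnorm_sum_eq_sup Finset.univ (fun i _ => .of_nonneg (hf i))
    (fun i j hij => horth i j hij)
  rw [← coe_nnnorm, this]
  exact NNReal.coe_le_one.2 (Finset.sup_le fun i _ => hf1 i)

/-- For a finite group action `α` on a simple C*-algebra, the weak
tracial Rokhlin property is equivalent to the variant in which orthogonality of the
`f g` is weakened to `‖f g * f h‖ < ε`, but in addition `f = ∑ g, f g` is required to
lie in the fixed point algebra and to have norm one. -/
theorem weakTracialRokhlin_iff_invariant_approx_orthogonal
    {G : Type*} [Group G] [Fintype G]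
    (hA : IsSimpleCStarAlgebra A)
    (α : G → A ≃⋆ₐ[ℂ] A) (hα : ∀ g h x, α (g * h) x = α g (α h x)) :
    WeakTracialRokhlin α ↔
      (∀ (ε : ℝ), 0 < ε → ∀ (F : Finset A) (x y : A), 0 ≤ x → 0 ≤ y → ‖x‖ = 1 →
        ∃ f : G → A,
          (∀ g, 0 ≤ f g) ∧ (∀ g, ‖f g‖ ≤ 1) ∧
          (∀ g h, g ≠ h → ‖f g * f h‖ < ε) ∧
          (∀ g, ∀ a ∈ F, ‖a * f g - f g * a‖ < ε) ∧
          (∀ g h, ‖α g (f h) - f (g * h)‖ < ε) ∧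
          CuntzLEIn Set.univ (cutdown (y * y - y * (∑ g : G, f g) * y) ε) x ∧
          ‖(∑ g : G, f g) * x * (∑ g : G, f g)‖ > 1 - ε ∧
          (∑ g : G, f g) ∈ fixedPts α ∧ ‖∑ g : G, f g‖ = 1) := by
  constructor
  · intro H ε hε F x y hx hy hx1
    set N := (Fintype.card G : ℝ) with hN
    obtain ⟨η, hη, hηε, hpert⟩ := exists_perturbation_bound α F hy hε
    obtain ⟨δ, hδ, hδε, hδN, hδη⟩ : ∃ δ > 0, δ ≤ ε / 2 ∧ (N + 1) * δ ≤ 1 / 2 ∧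
        2 * (N + 2) * δ ≤ η := by
      refine ⟨min (ε / 2) (min (1 / 2 / (N + 1)) (η / (2 * (N + 2)))), by positivity,
        min_le_left _ _, ?_, ?_⟩
      · rw [mul_comm, ← le_div_iff₀ (by positivity)]
        exact (min_le_right _ _).trans (min_le_left _ _)
      · rw [mul_comm, ← le_div_iff₀ (by positivity)]
        exact (min_le_right _ _).trans (min_le_right _ _)
    obtain ⟨f, hf, hf1, horth, hcomm, hαf, hC, hnorm⟩ := H δ hδ F x y hx hy hx1
    have hle := norm_sum_le_one_of_orthogonal hf hf1 horth
    have hge : 1 - δ ≤ ‖∑ g, f g‖ := by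
      have h1 : ‖(∑ g, f g) * x * ∑ g, f g‖ ≤ 1 * 1 * ‖∑ g, f g‖ :=
        norm_mul_le_of_le (norm_mul_le_of_le hle hx1.le) le_rfl
      linarith
    obtain ⟨e, he, he1, hef, hfix, he_one⟩ := exists_invariant_sum α hα hδN hf hf1 hle hge
      fun g h => (hαf g h).le
    have hef' : ∀ g, ‖e g - f g‖ ≤ η := fun g => (hef g).trans hδη
    obtain ⟨h1, h2, h3, h4⟩ :=
      hpert x hx1 δ hδ.le hδε f e hf he hle hef' hcomm hαf hC hnorm
    refine ⟨e, he, he1, fun g h hgh => ?_, h1, h2, h3, h4, hfix, he_one⟩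
    have heq : e g * e h = (e g - f g) * e h + f g * (e h - f h) := by
      rw [sub_mul, mul_sub, horth g h hgh]; abel
    rw [heq]
    refine (norm_add_le_of_le (norm_mul_le_of_le (hef' g) (he1 h))
      (norm_mul_le_of_le (hf1 g) (hef' h))).trans_lt ?_
    linarith
  · intro H ε hε F x y hx hy hx1
    obtain ⟨η, hη, -, hpert⟩ := exists_perturbation_bound α F hy hε
    obtain ⟨θ, hθ, horth⟩ := exists_orthogonal_contractions (A := A) G hη
    obtain ⟨f, hf, hf1, hff, hcomm, hαf, hC, hnorm, -, hf_one⟩ :=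
      H (min θ (ε / 2)) (lt_min hθ (half_pos hε)) F x y hx hy hx1
    obtain ⟨e, he, he1, hef, he_orth⟩ := horth f hf hf1 fun g h hgh =>
      (hff g h hgh).trans_le (min_le_left _ _)
    exact ⟨e, he, he1, he_orth, hpert x hx1 _ (le_min hθ.le (half_pos hε).le) (min_le_right _ _)
      f e hf he hf_one.le hef hcomm hαf hC hnorm⟩
end

section
/- Let A be a stably finite simple C*-algebra and let a ∈ A be a nonzero positive element. Then the following are equivalent: (i) there is no n ∈ ℕ and projection p ∈ M_n(A) such that diag(a, 0, …, 0) is Cuntz equivalent to p in M_n(A) (i.e., a is purely positive); (ii) 0 is an accumulation point of the spectrum of a. -/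
open Filter Topology

variable {A : Type*} [NonUnitalCStarAlgebra A] [PartialOrder A] [StarOrderedRing A]

/-- A C*-algebra `A` is stably finite if for every `n`, every `v` in the matrix algebra
over the minimal unitization `A⁺` with `v⋆ v = 1` also satisfies `v v⋆ = 1`. -/
def StablyFiniteCStar (A : Type*) [NonUnitalCStarAlgebra A] : Prop :=
  ∀ (n : ℕ) (v : Matrix (Fin n) (Fin n) (Unitization ℂ A)),
    star v * v = 1 → v * star v = 1

/-- Cuntz subequivalence in the matrix algebra `Mₙ(A)`: there is a sequence `(w k)` of
matrices with `w k * b * (w k)⋆ → a`.  (Since all C*-norms on `Mₙ(A)` are equivalent to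
the product topology, this is norm convergence.) -/
def CuntzLEM {n : ℕ} (a b : Matrix (Fin n) (Fin n) A) : Prop :=
  ∃ w : ℕ → Matrix (Fin n) (Fin n) A,
    Tendsto (fun k => w k * b * star (w k)) atTop (𝓝 a)

/-- In a C*-algebra whose isometries are unitary, an element `v` with `v⋆ v` invertible satisfies
`v (v⋆ v)⁻¹ v⋆ = 1`. -/
theorem mul_inverse_star_mul_self_mul_star {U : Type*} [CStarAlgebra U]
    (hfin : ∀ v : U, star v * v = 1 → v * star v = 1) {v : U} (hv : IsUnit (star v * v)) :
    v * Ring.inverse (star v * v) * star v = 1 := by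
  let _ := CStarAlgebra.spectralOrder U
  let _ := CStarAlgebra.spectralOrderedRing U
  have hpos : IsStrictlyPositive (star v * v) := hv.isStrictlyPositive (star_mul_self_nonneg v)
  have hinv : Ring.inverse (star v * v) = (star v * v) ^ (-1 : ℝ) :=
    CFC.inverse_eq_rpow_neg_one hpos
  set r : U := (star v * v) ^ (-(1 / 2) : ℝ) with hr
  have hrs : star r = r := (CFC.rpow_nonneg (a := star v * v)).isSelfAdjoint
  have hrr : r * r = Ring.inverse (star v * v) := by
    rw [hinv, hr, ← CFC.rpow_add hv]; norm_num
  have hcomm : r * (star v * v) = (star v * v) * r := by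
    have : r * (star v * v) ^ (1 : ℝ) = (star v * v) ^ (1 : ℝ) * r := by
      rw [hr, ← CFC.rpow_add hv, ← CFC.rpow_add hv, add_comm]
    rwa [CFC.rpow_one (star v * v)] at this
  have hiso : star (v * r) * (v * r) = 1 := by
    rw [star_mul, hrs, mul_assoc, ← mul_assoc (star v), ← hcomm, ← mul_assoc, hrr,
      Ring.inverse_mul_cancel _ hv]
  have := hfin _ hiso
  rwa [star_mul, hrs, mul_assoc, ← mul_assoc r, hrr, ← mul_assoc] at this

/-- If isometries are unitary, `a` is a limit of conjugates of a projection `p`, and `p` is nearly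
a conjugate `x a x⋆`, then nothing under `a` is orthogonal to `x`. -/
theorem star_mul_mul_eq_zero_of_tendsto_conj_projection {U : Type*} [CStarAlgebra U]
    (hfin : ∀ v : U, star v * v = 1 → v * star v = 1) {a p x h : U} {w : ℕ → U}
    (hps : star p = p) (hpp : p * p = p)
    (hw : Tendsto (fun k => w k * p * star (w k)) atTop (𝓝 a))
    (hpx : p * x = x) (hx : ‖x * a * star x - p‖ < 1) (hxh : x * a * h = 0) :
    star h * a * h = 0 := by
  set V : ℕ → U := fun k => p * star (w k) * star x + (1 - p) with hV
  set z : ℕ → U := fun k => p * star (w k) * h with hz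
  have hxp : star x * p = star x := by rw [← hps, ← star_mul, hpx]
  have hpq : p * (1 - p) = 0 := by rw [mul_sub, hpp, mul_one, sub_self]
  have hqp : (1 - p) * p = 0 := by rw [sub_mul, hpp, one_mul, sub_self]
  have hqq : (1 - p) * (1 - p) = 1 - p := by rw [mul_sub, hqp, mul_one, sub_zero]
  have hqs : star (1 - p) = 1 - p := by rw [star_sub, hps, star_one]
  have hVs (k) : star (V k) = x * w k * p + (1 - p) := by
    simp only [hV, star_add, star_mul, star_star, hps, hqs, mul_assoc]
  have hVV (k) : star (V k) * V k = x * (w k * p * star (w k)) * star x + (1 - p) := by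
    rw [hVs]
    simp only [hV, add_mul, mul_add, hqq]
    have e1 : x * w k * p * (p * star (w k) * star x) = x * (w k * p * star (w k)) * star x := by
      simp only [mul_assoc]; rw [← mul_assoc p p, hpp]
    have e2 : x * w k * p * (1 - p) = 0 := by rw [mul_assoc, hpq, mul_zero]
    have e3 : (1 - p) * (p * star (w k) * star x) = 0 := by
      rw [mul_assoc, ← mul_assoc, hqp, zero_mul]
    rw [e1, e2, e3]; simp
  have hVz (k) : star (V k) * z k = x * (w k * p * star (w k)) * h := by
    rw [hVs]
    simp only [hz, add_mul]
    have e1 : x * w k * p * (p * star (w k) * h) = x * (w k * p * star (w k)) * h := by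
      simp only [mul_assoc]; rw [← mul_assoc p p, hpp]
    have e3 : (1 - p) * (p * star (w k) * h) = 0 := by
      rw [mul_assoc, ← mul_assoc, hqp, zero_mul]
    rw [e1, e3, add_zero]
  have hzz (k) : star (z k) * z k = star h * (w k * p * star (w k)) * h := by
    simp only [hz, star_mul, star_star, hps, mul_assoc]
    rw [← mul_assoc p p, hpp]
  have hb : IsUnit (x * a * star x + (1 - p)) := by
    have := (Units.oneSub (-(x * a * star x - p)) (by rwa [norm_neg])).isUnit
    rw [Units.val_oneSub] at this
    convert this using 1
    abel
  have tVV : Tendsto (fun k => star (V k) * V k) atTop (𝓝 (x * a * star x + (1 - p))) := by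
    simp only [hVV]
    exact ((hw.const_mul x).mul_const _).add_const _
  have tVz : Tendsto (fun k => star (V k) * z k) atTop (𝓝 0) := by
    simp only [hVz]
    rw [← hxh]
    exact (hw.const_mul x).mul_const _
  have tzz : Tendsto (fun k => star (z k) * z k) atTop (𝓝 (star h * a * h)) := by
    simp only [hzz]
    exact (hw.const_mul _).mul_const _
  have tinv : Tendsto (fun k => Ring.inverse (star (V k) * V k)) atTop
      (𝓝 (Ring.inverse (x * a * star x + (1 - p)))) := by
    obtain ⟨u, hu⟩ := hb
    rw [← hu] at tVV ⊢
    exact (NormedRing.inverse_continuousAt u).tendsto.comp tVV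
  have hev : ∀ᶠ k in atTop, IsUnit (star (V k) * V k) :=
    tVV.eventually (Units.isOpen.mem_nhds hb)
  have t0 : Tendsto (fun k => star (star (V k) * z k) * Ring.inverse (star (V k) * V k) *
      (star (V k) * z k)) atTop (𝓝 0) := by
    simpa using (tVz.star.mul tinv).mul tVz
  refine tendsto_nhds_unique tzz (t0.congr' ?_)
  filter_upwards [hev] with k hk
  have := mul_inverse_star_mul_self_mul_star hfin hk
  calc _ = star (z k) * (V k * Ring.inverse (star (V k) * V k) * star (V k)) * z k := by
        simp only [star_mul, star_star, mul_assoc]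
    _ = _ := by rw [this, mul_one]

theorem exists_projection_of_not_accPt (a : A) (ha : 0 ≤ a)
    (h : ¬ AccPt (0 : ℝ) (𝓟 (quasispectrum ℝ a))) :
    ∃ p r s : A, star p = p ∧ p * p = p ∧ r * p * star r = a ∧ s * a * star s = p := by
  have hsa : IsSelfAdjoint a := ha.isSelfAdjoint
  obtain ⟨δ, hδ, hgap⟩ : ∃ δ > 0, ∀ t ∈ quasispectrum ℝ a, t ≠ 0 → δ ≤ t := by
    rw [accPt_iff_frequently, not_frequently, Metric.eventually_nhds_iff] at h
    obtain ⟨δ, hδ, h⟩ := h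
    refine ⟨δ, hδ, fun t ht ht0 => ?_⟩
    by_contra! hlt
    have h0 := quasispectrum_nonneg_of_nonneg a ha t ht
    exact h (by simpa [Real.dist_eq, abs_of_nonneg h0] using hlt) ⟨ht0, ht⟩
  have hcont (c : ℝ → ℝ) (hc : ContinuousOn c (Set.Ici δ)) (hc0 : c 0 = 0) :
      ContinuousOn c (quasispectrum ℝ a) := by
    refine ContinuousOn.mono (s := {0} ∪ Set.Ici δ) ?_ fun t ht => ?_
    · refine (continuousOn_singleton c 0).union_of_isClosed hc isClosed_singleton isClosed_Ici
    · by_cases ht0 : t = 0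
      · exact Or.inl ht0
      · exact Or.inr (hgap t ht ht0)
  set P : ℝ → ℝ := fun t => if t = 0 then 0 else 1 with hP
  have P0 : P 0 = 0 := by simp [hP]
  have cP : ContinuousOn P (quasispectrum ℝ a) := by
    refine hcont _ (continuousOn_const (c := (1 : ℝ)) |>.congr fun t ht => ?_) P0
    simp [hP, (hδ.trans_le ht).ne']
  set R : ℝ → ℝ := fun t => Real.sqrt t with hR
  have R0 : R 0 = 0 := by simp [hR]
  have cR : ContinuousOn R (quasispectrum ℝ a) := Real.continuous_sqrt.continuousOn
  set S : ℝ → ℝ := fun t => (Real.sqrt t)⁻¹ with hS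
  have S0 : S 0 = 0 := by simp [hS]
  have cS : ContinuousOn S (quasispectrum ℝ a) := by
    refine hcont _ (Real.continuous_sqrt.continuousOn.inv₀ fun t ht => ?_) S0
    exact (Real.sqrt_pos.2 (hδ.trans_le ht)).ne'
  have key (c : ℝ → ℝ) : star (cfcₙ c a) = cfcₙ c a := cfcₙ_predicate (R := ℝ) c a
  refine ⟨cfcₙ P a, cfcₙ R a, cfcₙ S a, key _, ?_, ?_, ?_⟩
  · rw [← cfcₙ_mul P P a]
    refine cfcₙ_congr fun t _ => ?_
    by_cases t0 : t = 0 <;> simp [hP, t0]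
  · rw [key, ← cfcₙ_mul R P a, ← cfcₙ_mul _ R a]
    conv_rhs => rw [← cfcₙ_id' ℝ a]
    refine cfcₙ_congr fun t ht => ?_
    have h0 := quasispectrum_nonneg_of_nonneg a ha t ht
    by_cases t0 : t = 0 <;> simp [hP, hR, t0, h0]
  · have e : cfcₙ S a * a = cfcₙ (fun t => S t * t) a := by
      rw [cfcₙ_mul S (fun t => t) a, cfcₙ_id' ℝ a]
    rw [key, e, ← cfcₙ_mul _ S a]
    refine cfcₙ_congr fun t ht => ?_
    have h0 := quasispectrum_nonneg_of_nonneg a ha t ht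
    by_cases t0 : t = 0
    · simp [hP, hS, t0]
    · have : Real.sqrt t ≠ 0 := (Real.sqrt_pos.2 (lt_of_le_of_ne h0 (Ne.symm t0))).ne'
      simp only [hP, hS, t0, if_false]
      field_simp
      exact (Real.sq_sqrt h0).symm

theorem exists_cutoffs_of_accPt (a : A) (ha : 0 ≤ a)
    (h : AccPt (0 : ℝ) (𝓟 (quasispectrum ℝ a))) {ε : ℝ} (hε : 0 < ε) :
    ∃ e f : A, star e = e ∧ ‖e * a * e - a‖ ≤ ε ∧ e * a * f = 0 ∧ star f * a * f ≠ 0 := by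
  have hsa : IsSelfAdjoint a := ha.isSelfAdjoint
  set δ := ε / 2 with hδ
  have hδ0 : 0 < δ := by positivity
  obtain ⟨E, cE, E0, hE0, hE1, hEε, hEδ⟩ : ∃ E : ℝ → ℝ, Continuous E ∧ E 0 = 0 ∧ (∀ t, 0 ≤ E t) ∧
      (∀ t, E t ≤ 1) ∧ (∀ t, ε ≤ t → E t = 1) ∧ ∀ t, t ≤ δ → E t = 0 := by
    refine ⟨fun t => min 1 (max 0 (t / δ - 1)), by fun_prop, by simp,
      fun t => le_min zero_le_one (le_max_left _ _), fun t => min_le_left _ _,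
      fun t ht => min_eq_left (le_max_of_le_right ?_), fun t ht => ?_⟩
    · rw [le_sub_iff_add_le, le_div_iff₀ hδ0]; linarith
    · have : t / δ - 1 ≤ 0 := by rw [sub_nonpos, div_le_one hδ0]; exact ht
      simp [max_eq_left this]
  obtain ⟨F, cF, F0, hFδ, hFpos⟩ : ∃ F : ℝ → ℝ, Continuous F ∧ F 0 = 0 ∧ (∀ t, δ ≤ t → F t = 0) ∧
      ∀ t, 0 < t → t < δ → 0 < F t := by
    refine ⟨fun t => t * max 0 (δ - t), by fun_prop, by simp, fun t ht => by simp [ht],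
      fun t h0 ht => mul_pos h0 (lt_max_of_lt_right (sub_pos.2 ht))⟩
  have key (c : ℝ → ℝ) : star (cfcₙ c a) = cfcₙ c a := cfcₙ_predicate (R := ℝ) c a
  have cmul {c d : ℝ → ℝ} (hc : Continuous c) (hc0 : c 0 = 0) (hd : Continuous d) (hd0 : d 0 = 0) :
      cfcₙ c a * a * cfcₙ d a = cfcₙ (fun t => c t * t * d t) a := by
    rw [cfcₙ_mul (fun t => c t * t) d a (hc.mul continuous_id).continuousOn (mul_zero _)
      hd.continuousOn hd0, cfcₙ_mul c (fun t => t) a hc.continuousOn hc0 continuousOn_id rfl,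
      cfcₙ_id' ℝ a]
  refine ⟨cfcₙ E a, cfcₙ F a, key _, ?_, ?_, ?_⟩
  · have : cfcₙ E a * a * cfcₙ E a - a = cfcₙ (fun t => E t * t * E t - t) a := by
      rw [cmul cE E0 cE E0, cfcₙ_sub (fun t => E t * t * E t) (fun t => t) a
        ((cE.mul continuous_id).mul cE).continuousOn (by rw [mul_zero, zero_mul])
          continuousOn_id rfl, cfcₙ_id' ℝ a]
    rw [this]
    refine norm_cfcₙ_le fun t ht => ?_
    have h0 := quasispectrum_nonneg_of_nonneg a ha t ht
    rw [Real.norm_eq_abs, abs_le]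
    rcases le_total t ε with htε | htε
    · have h1 : 0 ≤ E t * t * E t := mul_nonneg (mul_nonneg (hE0 t) h0) (hE0 t)
      have h2 : E t * t ≤ t := mul_le_of_le_one_left h0 (hE1 t)
      have h3 : E t * t * E t ≤ E t * t := mul_le_of_le_one_right (mul_nonneg (hE0 t) h0) (hE1 t)
      constructor <;> linarith
    · simp [hEε t htε, hε.le]
  · rw [cmul cE E0 cF F0, ← cfcₙ_const_zero ℝ a]
    refine cfcₙ_congr fun t _ => ?_
    rcases le_total t δ with htd | htd
    · simp [hEδ t htd]
    · simp [hFδ t htd]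
  · rw [key, cmul cF F0 cF F0]
    rw [accPt_iff_frequently] at h
    obtain ⟨t, ⟨ht0, ht⟩, htδ⟩ := (h.and_eventually (Iio_mem_nhds hδ0)).exists
    have hpos : 0 < t := lt_of_le_of_ne (quasispectrum_nonneg_of_nonneg a ha t ht) (Ne.symm ht0)
    intro hz
    have hle := norm_apply_le_norm_cfcₙ (fun t => F t * t * F t) a ht
      ((cF.mul continuous_id).mul cF).continuousOn (by rw [mul_zero, zero_mul])
    rw [hz, norm_zero] at hle
    have hFt := hFpos t hpos htδ
    have : 0 < F t * t * F t := by positivity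
    exact (norm_pos_iff.2 this.ne').not_ge hle

section MatrixInr

variable {B : Type*} {n : ℕ}

/-- The entrywise inclusion of `Mₙ(B)` into `Mₙ(B⁺)`. -/
def matrixInr (M : Matrix (Fin n) (Fin n) B) :
    CStarMatrix (Fin n) (Fin n) (Unitization ℂ B) :=
  CStarMatrix.ofMatrix (M.map (fun b => (b : Unitization ℂ B)))

theorem matrixInr_apply (M : Matrix (Fin n) (Fin n) B) (i j : Fin n) :
    matrixInr M i j = (M i j : Unitization ℂ B) := rfl

theorem matrixInr_injective :
    Function.Injective (matrixInr : Matrix (Fin n) (Fin n) B → _) :=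
  fun _ _ h => Matrix.map_injective Unitization.inr_injective h

variable [NonUnitalCStarAlgebra B]

theorem matrixInr_mul (M N : Matrix (Fin n) (Fin n) B) :
    matrixInr (M * N) = matrixInr M * matrixInr N := by
  refine CStarMatrix.ext fun i j => ?_
  rw [CStarMatrix.mul_apply, matrixInr_apply, Matrix.mul_apply]
  exact (map_sum (Unitization.inrNonUnitalStarAlgHom ℂ B) _ _).trans
    (Finset.sum_congr rfl fun k _ => Unitization.inr_mul ℂ _ _)

theorem matrixInr_star (M : Matrix (Fin n) (Fin n) B) :
    matrixInr (star M) = star (matrixInr M) :=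
  CStarMatrix.ext fun i j => Unitization.inr_star (R := ℂ) (M j i)

theorem matrixInr_zero : matrixInr (0 : Matrix (Fin n) (Fin n) B) = 0 :=
  CStarMatrix.ext fun _ _ => Unitization.inr_zero ℂ

theorem matrixInr_sub (M N : Matrix (Fin n) (Fin n) B) :
    matrixInr (M - N) = matrixInr M - matrixInr N :=
  CStarMatrix.ext fun i j => Unitization.inr_sub ℂ (M i j) (N i j)

theorem continuous_matrixInr :
    Continuous (matrixInr : Matrix (Fin n) (Fin n) B → _) :=
  (Continuous.matrix_map continuous_id
    (Unitization.continuous_inr : Continuous (fun b : B => (b : Unitization ℂ B))) :)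

/-- The matrix `diag(b, 0, …, 0)`. -/
abbrev corner (b : B) : Matrix (Fin (n + 1)) (Fin (n + 1)) B :=
  Matrix.diagonal fun i => if i = 0 then b else 0

theorem corner_mul (b c : B) : corner (n := n) (b * c) = corner b * corner c := by
  rw [corner, corner, corner, Matrix.diagonal_mul_diagonal]
  congr 1
  funext i
  split_ifs <;> simp

theorem corner_star (b : B) : corner (n := n) (star b) = star (corner b) := by
  rw [corner, corner, Matrix.star_eq_conjTranspose, Matrix.diagonal_conjTranspose]
  congr 1
  funext i
  rw [Pi.star_apply]
  split_ifs <;> simp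

theorem corner_sub (b c : B) : corner (n := n) (b - c) = corner b - corner c := by
  rw [corner, corner, corner, Matrix.diagonal_sub]
  congr 1
  funext i
  split_ifs <;> simp

theorem corner_zero : corner (n := n) (0 : B) = 0 := by
  simp [corner]

theorem corner_injective : Function.Injective (corner (B := B) (n := n)) := by
  intro b c h
  simpa using congrFun (Matrix.diagonal_injective h) 0

theorem continuous_corner : Continuous (corner (B := B) (n := n)) := by
  refine Continuous.matrix_diagonal (continuous_pi fun i => ?_)
  split_ifs
  · exact continuous_id
  · exact continuous_const

theorem cuntzLEM_of_conj {b p r : B} (h : r * p * star r = b) :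
    CuntzLEM (corner (n := n) b) (corner p) := by
  refine ⟨fun _ => corner r, ?_⟩
  beta_reduce
  rw [← corner_star, ← corner_mul, ← corner_mul, h]
  exact tendsto_const_nhds

end MatrixInr


/-- Let `A` be a stably finite simple C*-algebra and let `a ∈ A` be
a nonzero positive element.  Then `a` is purely positive (no `n ≥ 1` and projection
`p ∈ Mₙ(A)` with `diag(a, 0, …, 0)` Cuntz equivalent to `p` in `Mₙ(A)`) if and only if
`0` is an accumulation point of the spectrum of `a` (computed in the unitization, i.e.
the quasispectrum). -/
theorem purelyPositive_iff_accPt_zero_spectrum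
    (hA : IsSimpleCStarAlgebra A) (hsf : StablyFiniteCStar A)
    (a : A) (ha : 0 ≤ a) (ha0 : a ≠ 0) :
    (¬ ∃ (n : ℕ) (p : Matrix (Fin (n + 1)) (Fin (n + 1)) A),
        star p = p ∧ p * p = p ∧
        CuntzLEM (Matrix.diagonal fun i => if i = 0 then a else 0) p ∧
        CuntzLEM p (Matrix.diagonal fun i => if i = 0 then a else 0)) ↔
      AccPt (0 : ℝ) (Filter.principal (quasispectrum ℝ a)) := by
  constructor
  · intro hpure
    by_contra hacc
    obtain ⟨p, r, s, hps, hpp, hr, hs⟩ := exists_projection_of_not_accPt a ha hacc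
    exact hpure ⟨0, corner p, by rw [← corner_star, hps], by rw [← corner_mul, hpp],
      cuntzLEM_of_conj hr, cuntzLEM_of_conj hs⟩
  · rintro hacc ⟨n, p, hps, hpp, ⟨w, hw⟩, ⟨u, hu⟩⟩
    let _ := CStarAlgebra.spectralOrder (Unitization ℂ A)
    let _ := CStarAlgebra.spectralOrderedRing (Unitization ℂ A)
    have hfin : ∀ v : CStarMatrix (Fin (n + 1)) (Fin (n + 1)) (Unitization ℂ A),
        star v * v = 1 → v * star v = 1 := fun v hv => hsf (n + 1) v hv
    set ψ : A → CStarMatrix (Fin (n + 1)) (Fin (n + 1)) (Unitization ℂ A) :=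
      fun d => matrixInr (corner d) with hψ
    have ψmul (b c : A) : ψ (b * c) = ψ b * ψ c := by
      simp only [hψ, corner_mul, matrixInr_mul]
    have ψstar (b : A) : ψ (star b) = star (ψ b) := by
      simp only [hψ, corner_star, matrixInr_star]
    have ψsub (b c : A) : ψ (b - c) = ψ b - ψ c := by
      simp only [hψ, corner_sub, matrixInr_sub]
    have ψzero : ψ 0 = 0 := by
      simp only [hψ, corner_zero, matrixInr_zero]
    have ψcont : Continuous ψ := continuous_matrixInr.comp continuous_corner
    set P := matrixInr p with hP
    have hPs : star P = P := by rw [hP, ← matrixInr_star, hps]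
    have hPP : P * P = P := by rw [hP, ← matrixInr_mul, hpp]
    have hw' : Tendsto (fun k => matrixInr (w k) * P * star (matrixInr (w k))) atTop (𝓝 (ψ a)) := by
      have := (continuous_matrixInr.tendsto _).comp hw
      simpa only [Function.comp_def, matrixInr_mul, matrixInr_star] using this
    have hu' : Tendsto (fun k => matrixInr (u k) * ψ a * star (matrixInr (u k))) atTop (𝓝 P) := by
      have := (continuous_matrixInr.tendsto _).comp hu
      simpa only [Function.comp_def, matrixInr_mul, matrixInr_star] using this
    have hu'' : Tendsto (fun k => P * (matrixInr (u k) * ψ a * star (matrixInr (u k))) * P) atTop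
        (𝓝 P) := by
      have := (hu'.const_mul P).mul_const P
      rwa [hPP, hPP] at this
    obtain ⟨k, hk⟩ := (hu''.eventually (Metric.ball_mem_nhds P one_half_pos)).exists
    set y := P * matrixInr (u k) with hy
    have hPy : P * y = y := by rw [hy, ← mul_assoc, hPP]
    have hk' : ‖y * ψ a * star y - P‖ < 1 / 2 := by
      rw [dist_eq_norm] at hk
      simpa only [hy, star_mul, hPs, mul_assoc] using hk
    have hconj : Tendsto (fun d => y * ψ d * star y) (𝓝 0) (𝓝 0) := by
      have : Continuous fun d => y * ψ d * star y :=
        (continuous_const.mul ψcont).mul continuous_const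
      simpa [ψzero] using this.tendsto 0
    obtain ⟨ε, hε, hball⟩ := Metric.mem_nhds_iff.1
      (hconj (Metric.ball_mem_nhds (0 : CStarMatrix (Fin (n + 1)) (Fin (n + 1)) (Unitization ℂ A))
        one_half_pos))
    obtain ⟨e, f, he, hea, heaf, hfaf⟩ := exists_cutoffs_of_accPt a ha hacc (half_pos hε)
    have hclose : ‖y * ψ (e * a * e - a) * star y‖ < 1 / 2 := by
      have := hball (mem_ball_zero_iff.2 (hea.trans_lt (half_lt_self hε)))
      simpa using this
    refine hfaf (corner_injective (n := n) (matrixInr_injective ?_))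
    change ψ (star f * a * f) = ψ 0
    rw [ψzero, ψmul, ψmul, ψstar]
    refine star_mul_mul_eq_zero_of_tendsto_conj_projection hfin (x := y * ψ e) hPs hPP hw'
      (by rw [← mul_assoc, hPy]) ?_ ?_
    · have : y * ψ e * ψ a * star (y * ψ e) - P =
          y * ψ (e * a * e - a) * star y + (y * ψ a * star y - P) := by
        rw [star_mul, ← ψstar, he, ψsub, ψmul, ψmul]
        noncomm_ring
      rw [this]
      linarith [norm_add_le (y * ψ (e * a * e - a) * star y) (y * ψ a * star y - P)]
    · rw [mul_assoc, mul_assoc, ← ψmul, ← ψmul, ← mul_assoc e, heaf, ψzero, mul_zero]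
end
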